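/- arXiv:1208.4202 — 3 statements merged into one kernel-verified Lean document; each statement's English description precedes it below -/
import Mathlib

section
/- Let H be a Krull monoid. Then I_v^*(H), equipped with v-multiplication, is a free abelian monoid with basis the set of v-maximal v-ideals of H: every v-invertible divisorial ideal of H can be written as a v-product of v-maximal v-ideals, uniquely up to the order of the factors (equivalently, the multiset of v-maximal v-ideal factors is unique). -/
open scoped Pointwise

/-- `H` is a submonoid of the group `G` such that `G` is a left and a right
quotient group of `H` (i.e. `H` is a cancellative semigroup satisfying both
Ore conditions, embedded in its quotient group `G = q(H)`). -/
def IsQG {G : Type*} [Group G] (H : Submonoid G) : Prop :=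
  (∀ g : G, ∃ a ∈ H, ∃ b ∈ H, g = a⁻¹ * b) ∧ (∀ g : G, ∃ c ∈ H, ∃ d ∈ H, g = c * d⁻¹)

/-- Left quotient `(A :ₗ B) = {x ∈ G | x B ⊆ A}`. -/
def lq {G : Type*} [Group G] (A B : Set G) : Set G := {x | ∀ b ∈ B, x * b ∈ A}

/-- Right quotient `(A :ᵣ B) = {x ∈ G | B x ⊆ A}`. -/
def rq {G : Type*} [Group G] (A B : Set G) : Set G := {x | ∀ b ∈ B, b * x ∈ A}

/-- A fractional ideal of `H`: a two-sided `H`-module `𝔞 ⊆ G = q(H)` with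
`c𝔞 ⊆ H` and `𝔞d ⊆ H` for some `c, d ∈ H`. -/
def IsFracIdeal {G : Type*} [Group G] (H : Submonoid G) (a : Set G) : Prop :=
  (H : Set G) * a = a ∧ a * (H : Set G) = a ∧
  (∃ c ∈ H, ∀ x ∈ a, c * x ∈ H) ∧ (∃ d ∈ H, ∀ x ∈ a, x * d ∈ H)

/-- An ideal of `H`: a two-sided `H`-module contained in `H`. -/
def IsIdeal {G : Type*} [Group G] (H : Submonoid G) (a : Set G) : Prop :=
  a ⊆ (H : Set G) ∧ (H : Set G) * a = a ∧ a * (H : Set G) = a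

/-- The divisorial closure `𝔞_v = (H :ₗ (H :ᵣ 𝔞))`. -/
def vOp {G : Type*} [Group G] (H : Submonoid G) (a : Set G) : Set G :=
  lq (H : Set G) (rq (H : Set G) a)

/-- `H` is completely integrally closed:
`(𝔞 :ₗ 𝔞) = (𝔞 :ᵣ 𝔞) = H` for every non-empty ideal `𝔞` of `H`. -/
def IsCIC {G : Type*} [Group G] (H : Submonoid G) : Prop :=
  ∀ a : Set G, IsIdeal H a → a.Nonempty → lq a a = (H : Set G) ∧ rq a a = (H : Set G)

/-- A divisorial ideal (v-ideal) of `H`: an ideal with `𝔞 = 𝔞_v`. -/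
def IsDivIdeal {G : Type*} [Group G] (H : Submonoid G) (a : Set G) : Prop :=
  IsIdeal H a ∧ a = vOp H a

/-- A prime ideal of `H`: a proper ideal `𝔭` such that `aHb ⊆ 𝔭` implies
`a ∈ 𝔭` or `b ∈ 𝔭`. -/
def IsPrimeIdeal {G : Type*} [Group G] (H : Submonoid G) (p : Set G) : Prop :=
  IsIdeal H p ∧ p ≠ (H : Set G) ∧
  ∀ a ∈ H, ∀ b ∈ H, ({a} : Set G) * (H : Set G) * {b} ⊆ p → a ∈ p ∨ b ∈ p

/-- A v-maximal v-ideal of `H`: a maximal element (under inclusion) of the set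
of divisorial ideals of `H` distinct from `H`. -/
def IsVMax {G : Type*} [Group G] (H : Submonoid G) (m : Set G) : Prop :=
  IsDivIdeal H m ∧ m ≠ (H : Set G) ∧
  ∀ b : Set G, IsDivIdeal H b → b ≠ (H : Set G) → m ⊆ b → b = m

/-- A v-invertible divisorial ideal of `H`: a divisorial ideal `𝔞` with
`𝔞 ·_v 𝔞⁻¹ = 𝔞⁻¹ ·_v 𝔞 = H`, where `𝔞⁻¹ = (H : 𝔞)`. -/
def IsVInv {G : Type*} [Group G] (H : Submonoid G) (a : Set G) : Prop :=
  IsDivIdeal H a ∧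
  vOp H (a * lq (H : Set G) a) = (H : Set G) ∧
  vOp H (lq (H : Set G) a * a) = (H : Set G)

/-- `H` is v-noetherian: the ascending chain condition on divisorial ideals. -/
def VNoeth {G : Type*} [Group G] (H : Submonoid G) : Prop :=
  ∀ f : ℕ → Set G, (∀ n, IsDivIdeal H (f n)) → (∀ n, f n ⊆ f (n + 1)) →
    ∃ N, ∀ n, N ≤ n → f n = f N

/-- The v-product of a (finite) list of ideals, `𝔭₁ ·_v ⋯ ·_v 𝔭_k`,
with empty v-product `H`. -/
def vProd {G : Type*} [Group G] (H : Submonoid G) (l : List (Set G)) : Set G :=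
  l.foldr (fun p q => vOp H (p * q)) (H : Set G)

section KrullMonoid

variable {G : Type*} [Group G] {H : Submonoid G} {a b p q : Set G}

theorem IsIdeal.mul_mem_left (ha : IsIdeal H a) {h x : G} (hh : h ∈ H) (hx : x ∈ a) :
    h * x ∈ a :=
  ha.2.1 ▸ Set.mul_mem_mul hh hx

theorem IsIdeal.mul_mem_right (ha : IsIdeal H a) {h x : G} (hx : x ∈ a) (hh : h ∈ H) :
    x * h ∈ a :=
  ha.2.2 ▸ Set.mul_mem_mul hx hh

theorem IsIdeal.of_mul_mem (hsub : ∀ x ∈ a, x ∈ H) (hl : ∀ h ∈ H, ∀ x ∈ a, h * x ∈ a)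
    (hr : ∀ h ∈ H, ∀ x ∈ a, x * h ∈ a) : IsIdeal H a := by
  refine ⟨hsub, Set.Subset.antisymm ?_ fun x hx => ?_, Set.Subset.antisymm ?_ fun x hx => ?_⟩
  · rintro _ ⟨h, hh, x, hx, rfl⟩
    exact hl h hh x hx
  · exact ⟨1, H.one_mem, x, hx, one_mul x⟩
  · rintro _ ⟨x, hx, h, hh, rfl⟩
    exact hr h hh x hx
  · exact ⟨x, hx, 1, H.one_mem, mul_one x⟩

theorem IsIdeal.self : IsIdeal H (H : Set G) :=
  .of_mul_mem (fun _ hx => hx) (fun _ hh _ hx => H.mul_mem hh hx)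
    fun _ hh _ hx => H.mul_mem hx hh

theorem IsIdeal.mul (ha : IsIdeal H a) (hb : IsIdeal H b) : IsIdeal H (a * b) := by
  refine .of_mul_mem ?_ ?_ ?_
  · rintro _ ⟨x, hx, y, hy, rfl⟩
    exact H.mul_mem (ha.1 hx) (hb.1 hy)
  · rintro h hh _ ⟨x, hx, y, hy, rfl⟩
    exact ⟨h * x, ha.mul_mem_left hh hx, y, hy, mul_assoc h x y⟩
  · rintro h hh _ ⟨x, hx, y, hy, rfl⟩
    exact ⟨x, hx, y * h, hb.mul_mem_right hy hh, (mul_assoc x y h).symm⟩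

theorem IsIdeal.union (ha : IsIdeal H a) (hb : IsIdeal H b) : IsIdeal H (a ∪ b) :=
  .of_mul_mem (fun _ hx => hx.elim (fun h => ha.1 h) fun h => hb.1 h)
    (fun _ hh _ hx => hx.imp (ha.mul_mem_left hh) (hb.mul_mem_left hh))
    fun _ hh _ hx => hx.imp (ha.mul_mem_right · hh) (hb.mul_mem_right · hh)

theorem IsIdeal.inter (ha : IsIdeal H a) (hb : IsIdeal H b) : IsIdeal H (a ∩ b) :=
  .of_mul_mem (fun _ hx => ha.1 hx.1)
    (fun _ hh _ hx => ⟨ha.mul_mem_left hh hx.1, hb.mul_mem_left hh hx.2⟩)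
    fun _ hh _ hx => ⟨ha.mul_mem_right hx.1 hh, hb.mul_mem_right hx.2 hh⟩

theorem IsIdeal.mul_subset_left (ha : IsIdeal H a) (hb : IsIdeal H b) : a * b ⊆ a := by
  rintro _ ⟨x, hx, y, hy, rfl⟩
  exact ha.mul_mem_right hx (hb.1 hy)

theorem IsIdeal.mul_subset_right (ha : IsIdeal H a) (hb : IsIdeal H b) : a * b ⊆ b := by
  rintro _ ⟨x, hx, y, hy, rfl⟩
  exact hb.mul_mem_left (ha.1 hx) hy

theorem rq_anti (h : a ⊆ b) : rq (H : Set G) b ⊆ rq (H : Set G) a :=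
  fun _ hx y hy => hx y (h hy)

theorem vOp_mono (h : a ⊆ b) : vOp H a ⊆ vOp H b :=
  fun _ hx y hy => hx y (rq_anti h hy)

theorem subset_vOp : a ⊆ vOp H a := fun x hx _ hy => hy x hx

theorem rq_vOp : rq (H : Set G) (vOp H a) = rq (H : Set G) a :=
  Set.Subset.antisymm (rq_anti subset_vOp) fun _ hx _ hy => hy _ hx

theorem vOp_vOp : vOp H (vOp H a) = vOp H a :=
  congrArg (lq (H : Set G)) rq_vOp

theorem vOp_subset_of_rq_subset (h : rq (H : Set G) b ⊆ rq (H : Set G) a) :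
    vOp H a ⊆ vOp H b :=
  fun _ hx y hy => hx y (h hy)

theorem IsDivIdeal.vOp_subset (hb : IsDivIdeal H b) (h : a ⊆ b) : vOp H a ⊆ b :=
  (vOp_mono h).trans hb.2.symm.subset

theorem IsIdeal.mul_mem_rq (ha : IsIdeal H a) {h x : G} (hh : h ∈ H)
    (hx : x ∈ rq (H : Set G) a) : h * x ∈ rq (H : Set G) a := fun y hy => by
  rw [← mul_assoc]
  exact hx _ (ha.mul_mem_right hy hh)

theorem IsIdeal.isDivIdeal_vOp (ha : IsIdeal H a) : IsDivIdeal H (vOp H a) := by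
  refine ⟨.of_mul_mem (fun x hx => ?_) (fun h hh x hx y hy => ?_) fun h hh x hx y hy => ?_,
    vOp_vOp.symm⟩
  · simpa using hx 1 fun y hy => by simpa using ha.1 hy
  · rw [mul_assoc]
    exact H.mul_mem hh (hx y hy)
  · rw [mul_assoc]
    exact hx _ (ha.mul_mem_rq hh hy)

theorem IsDivIdeal.self : IsDivIdeal H (H : Set G) :=
  ⟨.self, Set.Subset.antisymm subset_vOp IsIdeal.self.isDivIdeal_vOp.1.1⟩

theorem IsDivIdeal.inter (ha : IsDivIdeal H a) (hb : IsDivIdeal H b) : IsDivIdeal H (a ∩ b) :=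
  ⟨ha.1.inter hb.1, Set.Subset.antisymm subset_vOp <|
    Set.subset_inter (ha.vOp_subset Set.inter_subset_left) (hb.vOp_subset Set.inter_subset_right)⟩

theorem vOp_mul_subset : vOp H a * b ⊆ vOp H (a * b) := by
  rintro _ ⟨x, hx, y, hy, rfl⟩ z hz
  rw [mul_assoc]
  refine hx _ fun w hw => ?_
  rw [← mul_assoc]
  exact hz _ (Set.mul_mem_mul hw hy)

theorem vOp_vOp_mul : vOp H (vOp H a * b) = vOp H (a * b) :=
  Set.Subset.antisymm ((vOp_mono vOp_mul_subset).trans vOp_vOp.subset)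
    (vOp_mono (Set.mul_subset_mul_right subset_vOp))

theorem lq_eq_rq (hcic : IsCIC H) (ha : IsIdeal H a) (hne : a.Nonempty) :
    lq (H : Set G) a = rq (H : Set G) a := by
  obtain ⟨hl, hr⟩ := hcic a ha hne
  refine Set.Subset.antisymm (fun x hx y hy => hl ▸ fun z hz => ?_)
    fun x hx y hy => hr ▸ fun z hz => ?_
  · rw [mul_assoc]
    exact ha.mul_mem_right hy (hx z hz)
  · rw [← mul_assoc]
    exact ha.mul_mem_left (hx z hz) hy

theorem vOp_mul_vOp (hcic : IsCIC H) (ha : IsIdeal H a) (hb : IsIdeal H b)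
    (hane : a.Nonempty) (hbne : b.Nonempty) : vOp H (a * vOp H b) = vOp H (a * b) := by
  have hv := hb.isDivIdeal_vOp.1
  have hvne := hbne.mono (subset_vOp (H := H))
  refine Set.Subset.antisymm (vOp_subset_of_rq_subset ?_)
    (vOp_mono (Set.mul_subset_mul_left subset_vOp))
  rw [← lq_eq_rq hcic (ha.mul hb) (hane.mul hbne), ← lq_eq_rq hcic (ha.mul hv) (hane.mul hvne)]
  rintro y hy _ ⟨x, hx, z, hz, rfl⟩
  rw [← mul_assoc]
  have : y * x ∈ lq (H : Set G) (vOp H b) := by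
    rw [lq_eq_rq hcic hv hvne, rq_vOp, ← lq_eq_rq hcic hb hbne]
    intro w hw
    rw [mul_assoc]
    exact hy _ (Set.mul_mem_mul hx hw)
  exact this z hz

theorem isIdeal_mul_rq (hp : IsIdeal H p) :
    IsIdeal H (p * rq (H : Set G) p) := by
  refine .of_mul_mem ?_ ?_ ?_
  · rintro _ ⟨x, hx, y, hy, rfl⟩
    exact hy x hx
  · rintro h hh _ ⟨x, hx, y, hy, rfl⟩
    exact ⟨h * x, hp.mul_mem_left hh hx, y, hy, mul_assoc h x y⟩
  · rintro h hh _ ⟨x, hx, y, hy, rfl⟩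
    refine ⟨x, hx, y * h, fun z hz => ?_, (mul_assoc x y h).symm⟩
    rw [← mul_assoc]
    exact H.mul_mem (hy z hz) hh

theorem isIdeal_rq_mul (hcic : IsCIC H) (hp : IsIdeal H p) (hne : p.Nonempty) :
    IsIdeal H (rq (H : Set G) p * p) := by
  refine .of_mul_mem ?_ ?_ ?_
  · rintro _ ⟨x, hx, y, hy, rfl⟩
    rw [← lq_eq_rq hcic hp hne] at hx
    exact hx y hy
  · rintro h hh _ ⟨x, hx, y, hy, rfl⟩
    exact ⟨h * x, hp.mul_mem_rq hh hx, y, hy, mul_assoc h x y⟩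
  · rintro h hh _ ⟨x, hx, y, hy, rfl⟩
    exact ⟨x, hx, y * h, hp.mul_mem_right hy hh, (mul_assoc x y h).symm⟩

theorem one_mem_rq (hp : IsIdeal H p) : (1 : G) ∈ rq (H : Set G) p :=
  fun y hy => by simpa using hp.1 hy

theorem mem_of_rq_mul_mem (hcic : IsCIC H) (hp : IsIdeal H p) (hne : p.Nonempty) {z : G}
    (h : ∀ u ∈ rq (H : Set G) p, u * z ∈ rq (H : Set G) p) : z ∈ H := by
  have := (hcic _ (isIdeal_mul_rq hp) (hne.mul ⟨1, one_mem_rq hp⟩)).2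
  rw [← SetLike.mem_coe, ← this]
  rintro _ ⟨x, hx, u, hu, rfl⟩
  exact ⟨x, hx, u * z, h u hu, (mul_assoc x u z).symm⟩

theorem mem_of_mul_rq_mem (hcic : IsCIC H) (hp : IsIdeal H p) (hne : p.Nonempty) {z : G}
    (h : ∀ u ∈ rq (H : Set G) p, z * u ∈ rq (H : Set G) p) : z ∈ H := by
  have := (hcic _ (isIdeal_rq_mul hcic hp hne) (.mul ⟨1, one_mem_rq hp⟩ hne)).1
  rw [← SetLike.mem_coe, ← this]
  rintro _ ⟨u, hu, x, hx, rfl⟩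
  exact ⟨z * u, h u hu, x, hx, mul_assoc z u x⟩

theorem isIdeal_rq (hcic : IsCIC H) (ha : IsIdeal H a) (hp : IsIdeal H p) (hne : p.Nonempty)
    (hap : a ⊆ p) : IsIdeal H (rq a p) := by
  refine .of_mul_mem (fun x hx => ?_) (fun h hh x hx y hy => ?_) fun h hh x hx y hy => ?_
  · rw [← SetLike.mem_coe, ← (hcic p hp hne).2]
    exact fun y hy => hap (hx y hy)
  · rw [← mul_assoc]
    exact hx _ (hp.mul_mem_right hy hh)
  · rw [← mul_assoc]
    exact ha.mul_mem_right (hx y hy) hh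

theorem rq_mul_mem_rq (ha : IsIdeal H a) {u x : G} (hu : u ∈ rq (H : Set G) p) (hx : x ∈ a) :
    u * x ∈ rq a p := fun y hy => by
  rw [← mul_assoc]
  exact ha.mul_mem_left (hu y hy) hx

theorem subset_rq (ha : IsIdeal H a) (hp : IsIdeal H p) : a ⊆ rq a p :=
  fun _ hx _ hy => ha.mul_mem_left (hp.1 hy) hx

/-- To contain is to divide: if `𝔞 ⊆ 𝔭` then `𝔞` is a `v`-multiple of `𝔭`. -/
theorem vOp_mul_rq (hcic : IsCIC H) (ha : IsDivIdeal H a) (hp : IsIdeal H p)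
    (hne : p.Nonempty) : vOp H (p * rq a p) = a := by
  refine Set.Subset.antisymm (ha.vOp_subset ?_) ?_
  · rintro _ ⟨x, hx, y, hy, rfl⟩
    exact hy x hx
  · refine ha.2.subset.trans (vOp_subset_of_rq_subset fun y hy x hx => ?_)
    refine mem_of_rq_mul_mem hcic hp hne fun u hu w hw => ?_
    have := hy _ (Set.mul_mem_mul hw (rq_mul_mem_rq ha.1 hu hx))
    simpa only [mul_assoc] using this

theorem IsDivIdeal.rq (hcic : IsCIC H) (ha : IsDivIdeal H a) (hane : a.Nonempty)
    (hp : IsIdeal H p) (hap : a ⊆ p) : IsDivIdeal H (rq a p) := by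
  have hpne := hane.mono hap
  have hc := isIdeal_rq hcic ha.1 hp hpne hap
  refine ⟨hc, Set.Subset.antisymm subset_vOp fun x hx y hy => ?_⟩
  have h := vOp_mul_vOp hcic hp hc hpne (hane.mono (subset_rq ha.1 hp))
  rw [vOp_mul_rq hcic ha hp hpne] at h
  exact h ▸ subset_vOp (Set.mul_mem_mul hy hx)

theorem subset_of_vOp_mul_eq (hcic : IsCIC H) (hp : IsIdeal H p) (hne : p.Nonempty)
    (hb : IsDivIdeal H b) (h : vOp H (p * a) = vOp H (p * b)) : a ⊆ b := by
  refine subset_vOp.trans ((vOp_subset_of_rq_subset fun y hy x hx => ?_).trans hb.2.symm.subset)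
  refine mem_of_mul_rq_mem hcic hp hne fun u hu w hw => ?_
  have hyu : y * u ∈ rq (H : Set G) (p * a) := by
    rw [← rq_vOp, h, rq_vOp]
    rintro _ ⟨s, hs, t, ht, rfl⟩
    have := hu _ (hp.mul_mem_right hs (hy t ht))
    simpa only [mul_assoc] using this
  simpa only [mul_assoc] using hyu _ (Set.mul_mem_mul hw hx)

theorem IsVMax.subset_or_subset (hp : IsVMax H p) (ha : IsIdeal H a) (hab : a * b ⊆ p)
    (hb : b ⊆ (H : Set G)) : a ⊆ p ∨ b ⊆ p := by
  refine or_iff_not_imp_left.2 fun hap => ?_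
  have hv := (ha.union hp.1.1).isDivIdeal_vOp
  have hH : vOp H (a ∪ p) = H := by
    by_contra hne
    have := hp.2.2 _ hv hne (Set.subset_union_right.trans subset_vOp)
    exact hap (this ▸ Set.subset_union_left.trans subset_vOp)
  intro x hx
  refine hp.1.vOp_subset (a := (a ∪ p) * b) ?_ (vOp_mul_subset ⟨1, ?_, x, hx, one_mul x⟩)
  · rw [Set.union_mul]
    refine Set.union_subset hab ?_
    rintro _ ⟨s, hs, t, ht, rfl⟩
    exact hp.1.1.mul_mem_right hs (hb ht)
  · rw [hH]
    exact H.one_mem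

theorem IsVMax.eq_of_subset (hp : IsVMax H p) (hq : IsVMax H q) (h : p ⊆ q) : p = q :=
  (hp.2.2 q hq.1 hq.2.1 h).symm

theorem IsVMax.vOp_mul_eq_inter (hcic : IsCIC H) (hp : IsVMax H p) (hq : IsVMax H q)
    (hpne : p.Nonempty) (hpq : p ≠ q) : vOp H (p * q) = p ∩ q := by
  have hsub : p * q ⊆ p ∩ q :=
    Set.subset_inter (hp.1.1.mul_subset_left hq.1.1) (hp.1.1.mul_subset_right hq.1.1)
  have hdiv := hp.1.inter hq.1
  refine Set.Subset.antisymm (hdiv.vOp_subset hsub) ?_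
  have hc := isIdeal_rq hcic hdiv.1 hp.1.1 hpne Set.inter_subset_left
  have hcq : rq (p ∩ q) p ⊆ q := by
    refine (hq.subset_or_subset hp.1.1 ?_ hc.1).resolve_left fun h => hpq (hp.eq_of_subset hq h)
    rintro _ ⟨x, hx, y, hy, rfl⟩
    exact (hy x hx).2
  rw [← vOp_mul_rq hcic hdiv hp.1.1 hpne]
  exact vOp_mono (Set.mul_subset_mul_left hcq)

theorem IsVMax.vOp_mul_comm (hcic : IsCIC H) (hp : IsVMax H p) (hq : IsVMax H q)
    (hpne : p.Nonempty) (hqne : q.Nonempty) : vOp H (p * q) = vOp H (q * p) := by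
  rcases eq_or_ne p q with rfl | hpq
  · rfl
  · rw [hp.vOp_mul_eq_inter hcic hq hpne hpq, hq.vOp_mul_eq_inter hcic hp hqne hpq.symm,
      Set.inter_comm]

theorem isDivIdeal_vProd {l : List (Set G)} (hl : ∀ p ∈ l, IsVMax H p) :
    IsDivIdeal H (vProd H l) := by
  induction l with
  | nil => exact .self
  | cons p l ih =>
    rw [List.forall_mem_cons] at hl
    exact (hl.1.1.1.mul (ih hl.2).1).isDivIdeal_vOp

theorem nonempty_vProd {l : List (Set G)} (hl : ∀ p ∈ l, p.Nonempty) :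
    (vProd H l).Nonempty := by
  induction l with
  | nil => exact ⟨1, H.one_mem⟩
  | cons p l ih =>
    rw [List.forall_mem_cons] at hl
    exact (hl.1.mul (ih hl.2)).mono subset_vOp

theorem vProd_subset {l : List (Set G)} (hl : ∀ p ∈ l, IsVMax H p) (hp : p ∈ l) :
    vProd H l ⊆ p := by
  induction l with
  | nil => simp at hp
  | cons q l ih =>
    rw [List.forall_mem_cons] at hl
    have hX := isDivIdeal_vProd hl.2
    rcases List.mem_cons.1 hp with rfl | h
    · exact hl.1.1.vOp_subset (hl.1.1.1.mul_subset_left hX.1)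
    · exact (hX.vOp_subset (hl.1.1.1.mul_subset_right hX.1)).trans (ih hl.2 h)

theorem vProd_perm (hcic : IsCIC H) {l₁ l₂ : List (Set G)} (h : l₁.Perm l₂)
    (hl : ∀ p ∈ l₁, IsVMax H p) (hne : ∀ p ∈ l₁, p.Nonempty) : vProd H l₁ = vProd H l₂ := by
  induction h with
  | nil => rfl
  | cons p _ ih =>
    rw [List.forall_mem_cons] at hl hne
    change vOp H (p * vProd H _) = vOp H (p * vProd H _)
    rw [ih hl.2 hne.2]
  | swap p q l =>
    simp only [List.forall_mem_cons] at hl hne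
    have hX := isDivIdeal_vProd hl.2.2
    have hXne := nonempty_vProd (H := H) hne.2.2
    change vOp H (q * vOp H (p * vProd H l)) = vOp H (p * vOp H (q * vProd H l))
    rw [vOp_mul_vOp hcic hl.1.1.1 (hl.2.1.1.1.mul hX.1) hne.1 (hne.2.1.mul hXne),
      vOp_mul_vOp hcic hl.2.1.1.1 (hl.1.1.1.mul hX.1) hne.2.1 (hne.1.mul hXne),
      ← mul_assoc, ← mul_assoc, ← vOp_vOp_mul, hl.1.vOp_mul_comm hcic hl.2.1 hne.1 hne.2.1,
      vOp_vOp_mul]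
  | trans h _ ih₁ ih₂ =>
    rw [ih₁ hl hne, ih₂ (fun p hp => hl p (h.mem_iff.2 hp)) fun p hp => hne p (h.mem_iff.2 hp)]

theorem IsVMax.mem_of_vProd_subset (hp : IsVMax H p) {l : List (Set G)}
    (hl : ∀ q ∈ l, IsVMax H q) (h : vProd H l ⊆ p) : p ∈ l := by
  induction l with
  | nil => exact absurd (Set.Subset.antisymm hp.1.1.1 h) hp.2.1
  | cons q l ih =>
    rw [List.forall_mem_cons] at hl
    rcases hp.subset_or_subset hl.1.1.1 (subset_vOp.trans h) (isDivIdeal_vProd hl.2).1.1 with h | h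
    · exact hl.1.eq_of_subset hp h ▸ List.mem_cons_self
    · exact List.mem_cons_of_mem _ (ih hl.2 h)

theorem perm_of_vProd_eq (hcic : IsCIC H) {l₁ l₂ : List (Set G)}
    (h₁ : ∀ p ∈ l₁, IsVMax H p) (h₂ : ∀ p ∈ l₂, IsVMax H p)
    (hne₁ : ∀ p ∈ l₁, p.Nonempty) (hne₂ : ∀ p ∈ l₂, p.Nonempty)
    (h : vProd H l₁ = vProd H l₂) : l₁.Perm l₂ := by
  classical
  induction l₁ generalizing l₂ with
  | nil =>
    cases l₂ with
    | nil => rfl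
    | cons p l =>
      have hp := h₂ p List.mem_cons_self
      exact absurd (Set.Subset.antisymm hp.1.1.1
        (h.subset.trans (vProd_subset h₂ List.mem_cons_self))) hp.2.1
  | cons p l ih =>
    have hmem : p ∈ l₂ := (h₁ p List.mem_cons_self).mem_of_vProd_subset h₂
      (h ▸ vProd_subset h₁ List.mem_cons_self)
    have hperm := List.perm_cons_erase hmem
    rw [List.forall_mem_cons] at h₁ hne₁
    have h₂' : ∀ q ∈ l₂.erase p, IsVMax H q := fun q hq => h₂ q (List.mem_of_mem_erase hq)
    have heq : vOp H (p * vProd H l) = vOp H (p * vProd H (l₂.erase p)) :=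
      h.trans (vProd_perm hcic hperm h₂ hne₂)
    refine .trans (.cons p (ih h₁.2 h₂' hne₁.2
      (fun q hq => hne₂ q (List.mem_of_mem_erase hq)) ?_)) hperm.symm
    exact Set.Subset.antisymm
      (subset_of_vOp_mul_eq hcic h₁.1.1.1 hne₁.1 (isDivIdeal_vProd h₂') heq)
      (subset_of_vOp_mul_eq hcic h₁.1.1.1 hne₁.1 (isDivIdeal_vProd h₁.2) heq.symm)

theorem VNoeth.wellFounded (hvn : VNoeth H) :
    WellFounded fun a b : {a : Set G // IsDivIdeal H a} => b < a := by
  have : WellFoundedGT {a : Set G // IsDivIdeal H a} := by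
    refine wellFoundedGT_iff_monotone_chain_condition.2 fun f => ?_
    obtain ⟨N, hN⟩ := hvn (fun n => (f n).1) (fun n => (f n).2) fun n => f.2 n.le_succ
    exact ⟨N, fun m hm => Subtype.ext (hN m hm).symm⟩
  exact this.wf

theorem VNoeth.exists_isVMax_superset (hvn : VNoeth H) (ha : IsDivIdeal H a)
    (hne : a ≠ (H : Set G)) : ∃ p, IsVMax H p ∧ a ⊆ p := by
  obtain ⟨p, ⟨hpH, hap⟩, hmax⟩ := hvn.wellFounded.has_min
    {b | b.1 ≠ (H : Set G) ∧ a ⊆ b.1} ⟨⟨a, ha⟩, hne, subset_rfl⟩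
  refine ⟨p.1, ⟨p.2, hpH, fun b hb hbH hpb => ?_⟩, hap⟩
  by_contra hbp
  exact hmax ⟨b, hb⟩ ⟨hbH, hap.trans hpb⟩ (lt_of_le_of_ne hpb fun h => hbp (congrArg Subtype.val h).symm)

theorem exists_vProd_eq (hcic : IsCIC H) (hvn : VNoeth H) (ha : IsDivIdeal H a)
    (hane : a.Nonempty) : ∃ l : List (Set G), (∀ p ∈ l, IsVMax H p) ∧ a = vProd H l := by
  suffices ∀ a : {a : Set G // IsDivIdeal H a}, a.1.Nonempty →
      ∃ l : List (Set G), (∀ p ∈ l, IsVMax H p) ∧ a.1 = vProd H l from this ⟨a, ha⟩ hane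
  intro a
  induction a using hvn.wellFounded.induction with
  | _ a ih =>
  intro hane
  by_cases haH : a.1 = H
  · exact ⟨[], by simp, haH⟩
  obtain ⟨p, hp, hap⟩ := hvn.exists_isVMax_superset a.2 haH
  have hpne := hane.mono hap
  have hsub := subset_rq a.2.1 hp.1.1
  have hne : a.1 ≠ rq a.1 p := fun h => by
    refine hp.2.1 (Set.Subset.antisymm hp.1.1.1 fun x hx => ?_)
    rw [hp.1.2]
    intro u hu
    refine H.mul_mem hx ?_
    rw [← SetLike.mem_coe, ← (hcic _ a.2.1 hane).1]
    exact fun y hy => h ▸ rq_mul_mem_rq a.2.1 hu hy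
  obtain ⟨l, hl, hlc⟩ := ih ⟨rq a.1 p, a.2.rq hcic hane hp.1.1 hap⟩
    (lt_of_le_of_ne hsub fun h => hne (congrArg Subtype.val h)) (hane.mono hsub)
  refine ⟨p :: l, List.forall_mem_cons.2 ⟨hp, hl⟩, ?_⟩
  change _ = vOp H (p * vProd H l)
  rw [← hlc, vOp_mul_rq hcic a.2 hp.1.1 hpne]

theorem IsVInv.nonempty (ha : IsVInv H a) : a.Nonempty := by
  rw [Set.nonempty_iff_ne_empty]
  rintro rfl
  have h := ha.2.1
  rw [Set.empty_mul, ← ha.1.2] at h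
  exact (h.symm ▸ H.one_mem : (1 : G) ∈ (∅ : Set G))

end KrullMonoid

/-- **Ideal theory of Krull monoids.** If `H` is a Krull monoid (completely
integrally closed and v-noetherian), then `I_v^*(H)` is free abelian with basis
the v-maximal v-ideals: every v-invertible divisorial ideal is a v-product of
v-maximal v-ideals, uniquely up to the order of the factors. -/
theorem stmt9 {G : Type*} [Group G] (H : Submonoid G) (hq : IsQG H)
    (hcic : IsCIC H) (hvn : VNoeth H) :
    ∀ a : Set G, IsVInv H a →
      (∃ l : List (Set G), (∀ p ∈ l, IsVMax H p) ∧ a = vProd H l) ∧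
      (∀ l₁ l₂ : List (Set G), (∀ p ∈ l₁, IsVMax H p) → (∀ p ∈ l₂, IsVMax H p) →
        a = vProd H l₁ → a = vProd H l₂ → l₁.Perm l₂) := by
  intro a ha
  refine ⟨exists_vProd_eq hcic hvn ha.1 ha.nonempty, fun l₁ l₂ h₁ h₂ e₁ e₂ => ?_⟩
  exact perm_of_vProd_eq hcic h₁ h₂ (fun p hp => ha.nonempty.mono (e₁ ▸ vProd_subset h₁ hp))
    (fun p hp => ha.nonempty.mono (e₂ ▸ vProd_subset h₂ hp)) (e₁.symm.trans e₂)
end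

section
/- Let H be a normalizing monoid (aH = Ha for all a ∈ H). Then for every a ∈ H the principal ideal aH is a v-invertible divisorial ideal, and the map ∂ : H → I_v^*(H) defined by ∂(a) = aH is a cofinal divisor homomorphism into the commutative monoid I_v^*(H) under v-multiplication; moreover (aH) ·_v (bH) = (aH)(bH) = abH for all a,b ∈ H. -/
open scoped Pointwise

theorem mul_mem_comm_of_normalizing {G : Type*} [Group G] {H : Submonoid G} (hq : IsQG H)
    (hnorm : ∀ a ∈ H, ({a} : Set G) * (H : Set G) = (H : Set G) * {a}) {x y : G}
    (h : x * y ∈ H) : y * x ∈ H := by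
  have conj : ∀ a ∈ H, ∀ k ∈ H, a * k * a⁻¹ ∈ H := by
    intro a ha k hk
    have hm : a * k ∈ (H : Set G) * {a} := hnorm a ha ▸ Set.mul_mem_mul rfl hk
    obtain ⟨l, hl, _, rfl, e⟩ := hm
    simpa [← e] using hl
  have conj_inv : ∀ a ∈ H, ∀ k ∈ H, a⁻¹ * k * a ∈ H := by
    intro a ha k hk
    have hm : k * a ∈ ({a} : Set G) * (H : Set G) := hnorm a ha ▸ Set.mul_mem_mul hk rfl
    obtain ⟨_, rfl, l, hl, e⟩ := hm
    simpa [mul_assoc, ← e] using hl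
  obtain ⟨a, ha, b, hb, rfl⟩ := hq.1 y
  have := conj_inv a ha _ (conj b hb _ h)
  simpa [mul_assoc] using this

/-- Membership of a product in `H` does not depend on the order of the factors; every
normalizing monoid has this property in its quotient group. -/
def MulMemComm {G : Type*} [Group G] (H : Submonoid G) : Prop :=
  ∀ x y : G, x * y ∈ H → y * x ∈ H

section MulMemComm

variable {G : Type*} [Group G] {H : Submonoid G}

theorem MulMemComm.rq_eq_lq (hc : MulMemComm H) (X : Set G) :
    rq (H : Set G) X = lq (H : Set G) X :=
  Set.ext fun _ => ⟨fun h b hb => hc _ _ (h b hb), fun h b hb => hc _ _ (h b hb)⟩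

theorem MulMemComm.vOp_eq (hc : MulMemComm H) (X : Set G) :
    vOp H X = lq (H : Set G) (lq (H : Set G) X) := by
  rw [vOp, hc.rq_eq_lq]

theorem MulMemComm.lq_mul_singleton (hc : MulMemComm H) (X : Set G) (u : G) :
    lq (H : Set G) (X * {u}) = {u⁻¹} * lq (H : Set G) X := by
  ext x
  simp only [lq, Set.mul_singleton, Set.singleton_mul, Set.image_mul_left, Set.image_mul_right,
    Set.mem_preimage, Set.mem_ofPred_eq, inv_inv, SetLike.mem_coe]
  constructor
  · intro h b hb
    have h2 : x * b * u ∈ H := by simpa [mul_assoc] using h (b * u) (by simpa using hb)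
    simpa [mul_assoc] using hc _ _ h2
  · intro h b hb
    have h2 : u * (x * (b * u⁻¹)) ∈ H := by simpa [mul_assoc] using h _ hb
    simpa [mul_assoc] using hc _ _ h2

theorem lq_singleton_mul (X : Set G) (u : G) :
    lq (H : Set G) ({u} * X) = lq (H : Set G) X * {u⁻¹} := by
  ext x
  simp only [lq, Set.mul_singleton, Set.singleton_mul, Set.image_mul_left, Set.image_mul_right,
    Set.mem_preimage, Set.mem_ofPred_eq, inv_inv, SetLike.mem_coe]
  constructor
  · intro h b hb
    simpa [mul_assoc] using h (u * b) (by simpa using hb)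
  · intro h b hb
    simpa [mul_assoc] using h _ hb

theorem MulMemComm.vOp_mul_singleton (hc : MulMemComm H) (X : Set G) (u : G) :
    vOp H (X * {u}) = vOp H X * {u} := by
  rw [hc.vOp_eq, hc.vOp_eq, hc.lq_mul_singleton, lq_singleton_mul, inv_inv]

theorem MulMemComm.vOp_singleton_mul (hc : MulMemComm H) (X : Set G) (u : G) :
    vOp H ({u} * X) = {u} * vOp H X := by
  rw [hc.vOp_eq, hc.vOp_eq, lq_singleton_mul, hc.lq_mul_singleton, inv_inv]

theorem MulMemComm.singleton_mul_coe (hc : MulMemComm H) (u : G) :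
    ({u} : Set G) * (H : Set G) = (H : Set G) * {u} := by
  ext x
  simp only [Set.mul_singleton, Set.singleton_mul, Set.image_mul_left, Set.image_mul_right,
    Set.mem_preimage, SetLike.mem_coe]
  exact ⟨hc _ _, hc _ _⟩

theorem lq_coe_self : lq (H : Set G) (H : Set G) = H :=
  Set.ext fun x => ⟨fun h => by simpa using h 1 H.one_mem, fun h _ hb => H.mul_mem h hb⟩

theorem MulMemComm.vOp_coe (hc : MulMemComm H) : vOp H (H : Set G) = H := by
  rw [hc.vOp_eq, lq_coe_self, lq_coe_self]

theorem vOp_mono_s12 {X Y : Set G} (h : X ⊆ Y) : vOp H X ⊆ vOp H Y :=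
  fun _ hx z hz => hx z fun b hb => hz b (h hb)

theorem singleton_mul_inv_singleton (u : G) : ({u} : Set G) * {u⁻¹} = 1 := by
  simp [Set.singleton_one]

theorem singleton_inv_mul_singleton (u : G) : ({u⁻¹} : Set G) * {u} = 1 := by
  simp [Set.singleton_one]

/-- A divisorial `H`-bimodule in `G` that is invertible under `v`-multiplication, not
necessarily contained in `H`. -/
structure IsVInvFrac (H : Submonoid G) (X : Set G) : Prop where
  coe_mul : (H : Set G) * X = X
  mul_coe : X * (H : Set G) = X
  vOp_eq : vOp H X = X
  vOp_mul_inv : vOp H (X * lq (H : Set G) X) = H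
  vOp_inv_mul : vOp H (lq (H : Set G) X * X) = H

theorem MulMemComm.isVInvFrac_coe (hc : MulMemComm H) : IsVInvFrac H (H : Set G) := by
  have hH : (H : Set G) * (H : Set G) = H := by simp
  constructor <;> simp only [lq_coe_self, hH, hc.vOp_coe]

theorem lq_bimodule_of_coe_mul_subset {X : Set G} (h : (H : Set G) * X ⊆ X) :
    (H : Set G) * lq (H : Set G) X = lq (H : Set G) X ∧
      lq (H : Set G) X * (H : Set G) = lq (H : Set G) X := by
  refine ⟨Set.Subset.antisymm ?_ fun x hx => ⟨1, H.one_mem, x, hx, one_mul x⟩,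
    Set.Subset.antisymm ?_ fun x hx => ⟨x, hx, 1, H.one_mem, mul_one x⟩⟩
  · rintro _ ⟨k, hk, x, hx, rfl⟩ b hb
    simpa [mul_assoc] using H.mul_mem hk (hx b hb)
  · rintro _ ⟨x, hx, k, hk, rfl⟩ b hb
    simpa [mul_assoc] using hx (k * b) (h (Set.mul_mem_mul hk hb))

theorem MulMemComm.isVInvFrac_lq (hc : MulMemComm H) {d : Set G} (hd : IsVInv H d) :
    IsVInvFrac H (lq (H : Set G) d) := by
  obtain ⟨⟨⟨-, hl, -⟩, hv⟩, h1, h2⟩ := hd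
  have hdd : lq (H : Set G) (lq (H : Set G) d) = d := by rw [← hc.vOp_eq, ← hv]
  obtain ⟨hL, hR⟩ := lq_bimodule_of_coe_mul_subset hl.subset
  exact ⟨hL, hR, by rw [hc.vOp_eq, hdd], by rw [hdd, h2], by rw [hdd, h1]⟩

theorem MulMemComm.isVInv_singleton_mul (hc : MulMemComm H) {X : Set G} (hX : IsVInvFrac H X)
    {u : G} (hu : {u} * X ⊆ (H : Set G)) : IsVInv H ({u} * X) := by
  refine ⟨⟨⟨hu, ?_, ?_⟩, ?_⟩, ?_, ?_⟩
  · rw [← mul_assoc, ← hc.singleton_mul_coe, mul_assoc, hX.coe_mul]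
  · rw [mul_assoc, hX.mul_coe]
  · rw [hc.vOp_singleton_mul, hX.vOp_eq]
  · rw [lq_singleton_mul, ← mul_assoc, hc.vOp_mul_singleton, mul_assoc, hc.vOp_singleton_mul,
      hX.vOp_mul_inv, hc.singleton_mul_coe, mul_assoc, singleton_mul_inv_singleton, mul_one]
  · rw [lq_singleton_mul, mul_assoc, ← mul_assoc ({u⁻¹} : Set G), singleton_inv_mul_singleton, one_mul,
      hX.vOp_inv_mul]

theorem MulMemComm.isVInv_mul_singleton (hc : MulMemComm H) {X : Set G} (hX : IsVInvFrac H X)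
    {u : G} (hu : X * {u} ⊆ (H : Set G)) : IsVInv H (X * {u}) := by
  refine ⟨⟨⟨hu, ?_, ?_⟩, ?_⟩, ?_, ?_⟩
  · rw [← mul_assoc, hX.coe_mul]
  · rw [mul_assoc, hc.singleton_mul_coe, ← mul_assoc, hX.mul_coe]
  · rw [hc.vOp_mul_singleton, hX.vOp_eq]
  · rw [hc.lq_mul_singleton, mul_assoc, ← mul_assoc ({u} : Set G), singleton_mul_inv_singleton, one_mul,
      hX.vOp_mul_inv]
  · rw [hc.lq_mul_singleton, ← mul_assoc, hc.vOp_mul_singleton, mul_assoc, hc.vOp_singleton_mul,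
      hX.vOp_inv_mul, hc.singleton_mul_coe, mul_assoc, singleton_inv_mul_singleton, mul_one]

theorem MulMemComm.vOp_principal (hc : MulMemComm H) (u : G) :
    vOp H (({u} : Set G) * (H : Set G)) = ({u} : Set G) * (H : Set G) := by
  rw [hc.vOp_singleton_mul, hc.vOp_coe]

theorem IsVInv.nonempty_s12 {d : Set G} (hd : IsVInv H d) : d.Nonempty := by
  rw [Set.nonempty_iff_ne_empty]
  rintro rfl
  obtain ⟨⟨-, hv⟩, h, -⟩ := hd
  rw [Set.empty_mul, ← hv] at h
  exact (h ▸ H.one_mem : (1 : G) ∈ (∅ : Set G))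

end MulMemComm

/-- For a normalizing monoid `H`, each principal ideal `aH` is a v-invertible
divisorial ideal, `(aH) ·_v (bH) = (aH)(bH) = abH`, and
`∂ : H → I_v^*(H)`, `∂(a) = aH`, is a cofinal divisor homomorphism. -/
theorem stmt12 {G : Type*} [Group G] (H : Submonoid G) (hq : IsQG H)
    (hnorm : ∀ a ∈ H, ({a} : Set G) * (H : Set G) = (H : Set G) * {a}) :
    -- `∂` maps into `I_v^*(H)`
    (∀ a ∈ H, IsVInv H (({a} : Set G) * (H : Set G))) ∧
    -- `∂` is multiplicative: `(aH) ·_v (bH) = (aH)(bH) = abH`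
    (∀ a ∈ H, ∀ b ∈ H,
      vOp H ((({a} : Set G) * (H : Set G)) * (({b} : Set G) * (H : Set G))) =
        (({a} : Set G) * (H : Set G)) * (({b} : Set G) * (H : Set G)) ∧
      (({a} : Set G) * (H : Set G)) * (({b} : Set G) * (H : Set G)) =
        ({a * b} : Set G) * (H : Set G)) ∧
    -- `∂` is a divisor homomorphism
    (∀ u ∈ H, ∀ v ∈ H,
      ((∃ c : Set G, IsVInv H c ∧
          ({v} : Set G) * (H : Set G) = vOp H ((({u} : Set G) * (H : Set G)) * c)) →
        v ∈ ({u} : Set G) * (H : Set G)) ∧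
      ((∃ c : Set G, IsVInv H c ∧
          ({v} : Set G) * (H : Set G) = vOp H (c * (({u} : Set G) * (H : Set G)))) →
        v ∈ (H : Set G) * ({u} : Set G))) ∧
    -- `∂` is cofinal
    (∀ d : Set G, IsVInv H d →
      (∃ u ∈ H, ∃ c : Set G, IsVInv H c ∧
        ({u} : Set G) * (H : Set G) = vOp H (d * c)) ∧
      (∃ v ∈ H, ∃ c : Set G, IsVInv H c ∧
        ({v} : Set G) * (H : Set G) = vOp H (c * d))) := by
  have hc : MulMemComm H := fun _ _ h => mul_mem_comm_of_normalizing hq hnorm h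
  have hmul : ∀ a b : G, (({a} : Set G) * (H : Set G)) * (({b} : Set G) * (H : Set G)) =
      ({a * b} : Set G) * (H : Set G) := by
    intro a b
    rw [mul_assoc, ← mul_assoc (H : Set G), ← hc.singleton_mul_coe b, mul_assoc ({b} : Set G),
      Submonoid.coe_mul_self_eq, ← mul_assoc, Set.singleton_mul_singleton]
  refine ⟨fun a ha => hc.isVInv_singleton_mul hc.isVInvFrac_coe ?_,
    fun a _ b _ => ⟨?_, hmul a b⟩, fun u _ v _ => ⟨?_, ?_⟩, fun d hd => ?_⟩
  · rintro _ ⟨_, rfl, k, hk, rfl⟩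
    exact H.mul_mem ha hk
  · rw [hmul, hc.vOp_principal]
  · rintro ⟨c, hcV, e⟩
    have hv : v ∈ ({v} : Set G) * (H : Set G) := ⟨v, rfl, 1, H.one_mem, mul_one v⟩
    rw [e, mul_assoc, hcV.1.1.2.1] at hv
    have := vOp_mono_s12 (Set.mul_subset_mul_left hcV.1.1.1) hv
    rwa [hc.vOp_principal] at this
  · rintro ⟨c, hcV, e⟩
    have hv : v ∈ ({v} : Set G) * (H : Set G) := ⟨v, rfl, 1, H.one_mem, mul_one v⟩
    rw [e, hc.singleton_mul_coe, ← mul_assoc, hcV.1.1.2.2] at hv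
    have := vOp_mono_s12 (Set.mul_subset_mul_right hcV.1.1.1) hv
    rwa [hc.vOp_mul_singleton, hc.vOp_coe] at this
  · obtain ⟨u, hu⟩ := hd.nonempty_s12
    have huH : u ∈ H := hd.1.1.1 hu
    refine ⟨⟨u, huH, lq H d * {u}, hc.isVInv_mul_singleton (hc.isVInvFrac_lq hd) ?_, ?_⟩,
      ⟨u, huH, {u} * lq H d, hc.isVInv_singleton_mul (hc.isVInvFrac_lq hd) ?_, ?_⟩⟩
    · rintro _ ⟨x, hx, _, rfl, rfl⟩
      exact hx _ hu
    · rw [← mul_assoc, hc.vOp_mul_singleton, hd.2.1, hc.singleton_mul_coe]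
    · rintro _ ⟨_, rfl, x, hx, rfl⟩
      exact hc _ _ (hx _ hu)
    · rw [mul_assoc, hc.vOp_singleton_mul, hd.2.2]
end

section
/- Let H be a monoid, D a normalizing monoid, and φ : H → D a divisor homomorphism. Then: (1) if D is v-noetherian, then H is v-noetherian; (2) if D is a Krull monoid, then H is a normalizing Krull monoid. -/
open scoped Pointwise

/-- A divisorial ideal of `H`: an ideal `𝔞` with
`𝔞 = (H :ₗ (H :ᵣ 𝔞)) = (H :ᵣ (H :ₗ 𝔞))`. -/
def IsDivIdealFull {G : Type*} [Group G] (H : Submonoid G) (a : Set G) : Prop :=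
  IsIdeal H a ∧ a = lq (H : Set G) (rq (H : Set G) a) ∧
    a = rq (H : Set G) (lq (H : Set G) a)

/-- `H` is v-noetherian: the ascending chain condition on divisorial ideals. -/
def VNoethFull {G : Type*} [Group G] (H : Submonoid G) : Prop :=
  ∀ f : ℕ → Set G, (∀ n, IsDivIdealFull H (f n)) → (∀ n, f n ⊆ f (n + 1)) →
    ∃ N, ∀ n, N ≤ n → f n = f N

/-- `H` is a Krull monoid: completely integrally closed and v-noetherian. -/
def IsKrull {G : Type*} [Group G] (H : Submonoid G) : Prop :=
  IsCIC H ∧ VNoethFull H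

section Normalizing

variable {G : Type*} [Group G] {D : Submonoid G}

/-- A normalizing monoid is invariant under conjugation by its quotient group. -/
theorem conj_mem_of_normalizing (hq : IsQG D)
    (hn : ∀ d ∈ D, ({d} : Set G) * (D : Set G) = (D : Set G) * {d})
    (g : G) {d : G} (hd : d ∈ D) : g * d * g⁻¹ ∈ D := by
  have conj : ∀ c ∈ D, ∀ x ∈ D, c * x * c⁻¹ ∈ D := by
    intro c hc x hx
    have hmem : c * x ∈ (D : Set G) * {c} := by
      rw [← hn c hc]
      exact Set.mul_mem_mul rfl hx
    obtain ⟨y, hy, _, he, hyx⟩ := hmem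
    rw [Set.mem_singleton_iff.1 he] at hyx
    have : c * x * c⁻¹ = y := by rw [← hyx]; simp
    exact this ▸ hy
  have conj_inv : ∀ c ∈ D, ∀ x ∈ D, c⁻¹ * x * c ∈ D := by
    intro c hc x hx
    have hmem : x * c ∈ ({c} : Set G) * (D : Set G) := by
      rw [hn c hc]
      exact Set.mul_mem_mul hx rfl
    obtain ⟨_, he, y, hy, hyx⟩ := hmem
    rw [Set.mem_singleton_iff.1 he] at hyx
    have : c⁻¹ * x * c = y := by rw [mul_assoc, ← hyx]; simp
    exact this ▸ hy
  obtain ⟨a, ha, b, hb, rfl⟩ := hq.1 g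
  have := conj_inv a ha _ (conj b hb d hd)
  simpa [mul_assoc] using this

theorem subset_lq_rq (D : Submonoid G) (A : Set G) :
    A ⊆ lq (D : Set G) (rq (D : Set G) A) :=
  fun _ hx _ hy => hy _ hx

theorem mul_mem_comm_of_conj_mem (hconj : ∀ g : G, ∀ d ∈ D, g * d * g⁻¹ ∈ D)
    {x y : G} (h : x * y ∈ D) : y * x ∈ D := by
  simpa [mul_assoc] using hconj y _ h

theorem rq_eq_lq_of_conj_mem (hconj : ∀ g : G, ∀ d ∈ D, g * d * g⁻¹ ∈ D)
    (A : Set G) : rq (D : Set G) A = lq (D : Set G) A := by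
  ext x
  exact forall₂_congr fun b _ =>
    ⟨mul_mem_comm_of_conj_mem hconj, mul_mem_comm_of_conj_mem hconj⟩

/-- In a conjugation invariant monoid, the divisorial closure of a subset is a divisorial ideal. -/
theorem isDivIdealFull_vOp_of_conj_mem (hconj : ∀ g : G, ∀ d ∈ D, g * d * g⁻¹ ∈ D)
    {A : Set G} (hA : A ⊆ D) : IsDivIdealFull D (vOp D A) := by
  have hclosed : vOp D A = lq (D : Set G) (rq (D : Set G) (vOp D A)) :=
    (subset_lq_rq D _).antisymm fun x hx y hy => hx y fun _ hz => hz y hy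
  refine ⟨⟨fun x hx => ?_, ?_, ?_⟩, hclosed, ?_⟩
  · simpa using hx 1 fun b hb => by simpa using hA hb
  · refine Set.Subset.antisymm ?_ fun x hx => ⟨1, D.one_mem, x, hx, one_mul x⟩
    rintro _ ⟨d, hd, x, hx, rfl⟩ b hb
    simpa [mul_assoc] using D.mul_mem hd (hx b hb)
  · refine Set.Subset.antisymm ?_ fun x hx => ⟨x, hx, 1, D.one_mem, mul_one x⟩
    rintro _ ⟨x, hx, d, hd, rfl⟩ b hb
    simpa [mul_assoc] using D.mul_mem (hx b hb) (hconj b⁻¹ d hd)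
  · rwa [rq_eq_lq_of_conj_mem hconj, ← rq_eq_lq_of_conj_mem hconj (vOp D A)]

/-- In a conjugation invariant monoid, every subset generates an ideal as a left module. -/
theorem isIdeal_mul_of_conj_mem (hconj : ∀ g : G, ∀ d ∈ D, g * d * g⁻¹ ∈ D)
    {A : Set G} (hA : A ⊆ D) : IsIdeal D ((D : Set G) * A) := by
  refine ⟨?_, ?_, ?_⟩
  · rintro _ ⟨d, hd, x, hx, rfl⟩
    exact D.mul_mem hd (hA hx)
  · rw [← mul_assoc, Submonoid.coe_mul_self_eq]
  · refine Set.Subset.antisymm ?_ fun x hx => ⟨x, hx, 1, D.one_mem, mul_one x⟩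
    rintro _ ⟨_, ⟨d, hd, x, hx, rfl⟩, e, he, rfl⟩
    exact ⟨d * (x * e * x⁻¹), D.mul_mem hd (hconj x e he), x, hx, by simp [mul_assoc]⟩

end Normalizing

section DivisorHom

variable {G₁ : Type*} [Group G₁] {G₂ : Type*} [Group G₂] {H : Submonoid G₁} {D : Submonoid G₂}
  {φ : ↥H →* ↥D}

theorem inv_mul_mem_of_map_inv_mul_mem
    (hdiv : ∀ u v : ↥H, (∃ d : ↥D, φ v = φ u * d) → ∃ h : ↥H, v = u * h)
    {u v : ↥H} (h : (φ u : G₂)⁻¹ * φ v ∈ D) : (u : G₁)⁻¹ * v ∈ H := by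
  obtain ⟨w, rfl⟩ := hdiv u v ⟨⟨_, h⟩, Subtype.ext (by simp)⟩
  simp

theorem mul_inv_mem_of_map_mul_inv_mem
    (hdiv : ∀ u v : ↥H, (∃ d : ↥D, φ v = d * φ u) → ∃ h : ↥H, v = h * u)
    {u v : ↥H} (h : (φ v : G₂) * (φ u : G₂)⁻¹ ∈ D) : (v : G₁) * (u : G₁)⁻¹ ∈ H := by
  obtain ⟨w, rfl⟩ := hdiv u v ⟨⟨_, h⟩, Subtype.ext (by simp)⟩
  simp

/-- The image in `G₂` of a subset of `H` under `φ`. -/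
def imageInQuotient (φ : ↥H →* ↥D) (a : Set G₁) : Set G₂ :=
  {y | ∃ z : ↥H, (z : G₁) ∈ a ∧ (φ z : G₂) = y}

theorem imageInQuotient_subset (a : Set G₁) : imageInQuotient φ a ⊆ D := by
  rintro _ ⟨z, -, rfl⟩
  exact (φ z).2

theorem mem_vOp_of_map_mem_vOp (hqH : IsQG H)
    (hdiv : ∀ u v : ↥H, (∃ d : ↥D, φ v = d * φ u) → ∃ h : ↥H, v = h * u)
    {a : Set G₁} {x : ↥H} (hx : (φ x : G₂) ∈ vOp D (imageInQuotient φ a)) :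
    (x : G₁) ∈ vOp H a := by
  intro y hy
  obtain ⟨c, hc, d, hd, rfl⟩ := hqH.2 y
  have key : (φ ⟨c, hc⟩ : G₂) * (φ ⟨d, hd⟩ : G₂)⁻¹ ∈
      rq (D : Set G₂) (imageInQuotient φ a) := by
    rintro _ ⟨z, hz, rfl⟩
    have hw : (z : G₁) * (c * d⁻¹) ∈ H := hy z hz
    have heq : z * ⟨c, hc⟩ = ⟨_, hw⟩ * ⟨d, hd⟩ := Subtype.ext (by simp [mul_assoc])
    have hmap := congrArg (Subtype.val : D → G₂) (congrArg φ heq)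
    simp only [map_mul, Submonoid.coe_mul] at hmap
    rw [← mul_assoc, hmap, mul_inv_cancel_right]
    exact (φ _).2
  have hmem : (φ (x * ⟨c, hc⟩) : G₂) * (φ ⟨d, hd⟩ : G₂)⁻¹ ∈ D := by
    simpa [mul_assoc] using hx _ key
  simpa [mul_assoc] using mul_inv_mem_of_map_mul_inv_mem hdiv hmem

theorem normalizing_of_divisorHom
    (hDnorm : ∀ d ∈ D, ({d} : Set G₂) * (D : Set G₂) = (D : Set G₂) * {d})
    (hdiv : ∀ u v : ↥H,
      ((∃ d : ↥D, φ v = φ u * d) → ∃ h : ↥H, v = u * h) ∧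
      ((∃ d : ↥D, φ v = d * φ u) → ∃ h : ↥H, v = h * u))
    {a : G₁} (ha : a ∈ H) : ({a} : Set G₁) * (H : Set G₁) = (H : Set G₁) * {a} := by
  have hn := hDnorm _ (φ ⟨a, ha⟩).2
  apply Set.Subset.antisymm
  · rintro _ ⟨_, rfl, h, hh, rfl⟩
    have hmem : (φ ⟨_, ha⟩ : G₂) * (φ ⟨h, hh⟩ : G₂) ∈ (D : Set G₂) * {(φ ⟨_, ha⟩ : G₂)} := by
      rw [← hn]
      exact Set.mul_mem_mul rfl (φ _).2
    obtain ⟨e, he, _, rfl, hee⟩ := hmem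
    obtain ⟨k, hk⟩ := (hdiv ⟨_, ha⟩ (⟨_, ha⟩ * ⟨h, hh⟩)).2
      ⟨⟨e, he⟩, by rw [map_mul]; exact Subtype.ext hee.symm⟩
    exact ⟨k, k.2, _, rfl, (congrArg Subtype.val hk).symm⟩
  · rintro _ ⟨h, hh, _, rfl, rfl⟩
    have hmem : (φ ⟨h, hh⟩ : G₂) * (φ ⟨_, ha⟩ : G₂) ∈ {(φ ⟨_, ha⟩ : G₂)} * (D : Set G₂) := by
      rw [hn]
      exact Set.mul_mem_mul (φ _).2 rfl
    obtain ⟨_, rfl, e, he, hee⟩ := hmem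
    obtain ⟨k, hk⟩ := (hdiv ⟨_, ha⟩ (⟨h, hh⟩ * ⟨_, ha⟩)).1
      ⟨⟨e, he⟩, by rw [map_mul]; exact Subtype.ext hee.symm⟩
    exact ⟨_, rfl, k, k.2, (congrArg Subtype.val hk).symm⟩

theorem vNoethFull_of_divisorHom (hqH : IsQG H)
    (hconj : ∀ g : G₂, ∀ d ∈ D, g * d * g⁻¹ ∈ D)
    (hdiv : ∀ u v : ↥H, (∃ d : ↥D, φ v = d * φ u) → ∃ h : ↥H, v = h * u)
    (hD : VNoethFull D) : VNoethFull H := by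
  intro f hf hmono
  obtain ⟨N, hN⟩ := hD (fun n => vOp D (imageInQuotient φ (f n)))
    (fun n => isDivIdealFull_vOp_of_conj_mem hconj (imageInQuotient_subset _)) (by
      rintro n x hx y hy
      refine hx y ?_
      rintro _ ⟨z, hz, rfl⟩
      exact hy _ ⟨z, hmono n hz, rfl⟩)
  refine ⟨N, fun n hn => Set.Subset.antisymm (fun x hx => ?_) (monotone_nat_of_le_succ hmono hn)⟩
  have hxH : x ∈ H := (hf n).1.1 hx
  have hmem : (φ ⟨x, hxH⟩ : G₂) ∈ vOp D (imageInQuotient φ (f N)) := by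
    rw [← hN n hn]
    exact subset_lq_rq D _ ⟨_, hx, rfl⟩
  rw [(hf N).2.1]
  exact mem_vOp_of_map_mem_vOp hqH hdiv hmem

theorem isCIC_of_divisorHom (hqH : IsQG H)
    (hconj : ∀ g : G₂, ∀ d ∈ D, g * d * g⁻¹ ∈ D)
    (hdiv : ∀ u v : ↥H,
      ((∃ d : ↥D, φ v = φ u * d) → ∃ h : ↥H, v = u * h) ∧
      ((∃ d : ↥D, φ v = d * φ u) → ∃ h : ↥H, v = h * u))
    (hD : IsCIC D) : IsCIC H := by
  rintro a ⟨haH, hleft, hright⟩ ⟨x₀, hx₀⟩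
  obtain ⟨hl, hr⟩ := hD ((D : Set G₂) * imageInQuotient φ a)
    (isIdeal_mul_of_conj_mem hconj (imageInQuotient_subset _))
    ⟨_, Set.mul_mem_mul D.one_mem ⟨⟨x₀, haH hx₀⟩, hx₀, rfl⟩⟩
  constructor
  · refine Set.Subset.antisymm (fun x hx => ?_) fun x hx b hb =>
      hleft.subset (Set.mul_mem_mul hx hb)
    obtain ⟨c, hc, e, he, rfl⟩ := hqH.1 x
    refine inv_mul_mem_of_map_inv_mul_mem (φ := φ) (u := ⟨c, hc⟩) (v := ⟨e, he⟩)
      (fun u v => (hdiv u v).1) ?_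
    refine hl.subset ?_
    rintro _ ⟨d, hd, _, ⟨z, hz, rfl⟩, rfl⟩
    have hz' : c⁻¹ * e * z ∈ a := hx z hz
    have heq : ⟨e, he⟩ * z = ⟨c, hc⟩ * ⟨_, haH hz'⟩ := Subtype.ext (by simp [mul_assoc])
    have hmap := congrArg (Subtype.val : D → G₂) (congrArg φ heq)
    simp only [map_mul, Submonoid.coe_mul] at hmap
    refine ⟨_, hconj ((φ ⟨c, hc⟩ : G₂)⁻¹ * φ ⟨e, he⟩) d hd, _,
      ⟨⟨_, haH hz'⟩, hz', rfl⟩, ?_⟩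
    rw [← inv_mul_eq_iff_eq_mul] at hmap
    beta_reduce
    rw [← hmap]
    simp [mul_assoc]
  · refine Set.Subset.antisymm (fun x hx => ?_) fun x hx b hb =>
      hright.subset (Set.mul_mem_mul hb hx)
    obtain ⟨e, he, c, hc, rfl⟩ := hqH.2 x
    refine mul_inv_mem_of_map_mul_inv_mem (φ := φ) (u := ⟨c, hc⟩) (v := ⟨e, he⟩)
      (fun u v => (hdiv u v).2) ?_
    refine hr.subset ?_
    rintro _ ⟨d, hd, _, ⟨z, hz, rfl⟩, rfl⟩
    have hz' : z * (e * c⁻¹) ∈ a := hx z hz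
    have heq : z * ⟨e, he⟩ = ⟨_, haH hz'⟩ * ⟨c, hc⟩ := Subtype.ext (by simp [mul_assoc])
    have hmap := congrArg (Subtype.val : D → G₂) (congrArg φ heq)
    simp only [map_mul, Submonoid.coe_mul] at hmap
    refine ⟨d, hd, _, ⟨⟨_, haH hz'⟩, hz', rfl⟩, ?_⟩
    simp only [mul_assoc]
    rw [← mul_assoc (φ z : G₂), hmap, mul_inv_cancel_right]

end DivisorHom

/-- Let `φ : H → D` be a divisor homomorphism into a normalizing monoid `D`.
Then: (1) if `D` is v-noetherian, so is `H`; (2) if `D` is a Krull monoid,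
then `H` is a normalizing Krull monoid. -/
theorem stmt15 {G₁ : Type*} [Group G₁] {G₂ : Type*} [Group G₂]
    (H : Submonoid G₁) (hqH : IsQG H) (D : Submonoid G₂) (hqD : IsQG D)
    (hDnorm : ∀ d ∈ D, ({d} : Set G₂) * (D : Set G₂) = (D : Set G₂) * {d})
    (φ : ↥H →* ↥D)
    (hdiv : ∀ u v : ↥H,
      ((∃ d : ↥D, φ v = φ u * d) → ∃ h : ↥H, v = u * h) ∧
      ((∃ d : ↥D, φ v = d * φ u) → ∃ h : ↥H, v = h * u)) :
    (VNoethFull D → VNoethFull H) ∧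
    (IsKrull D → IsKrull H ∧
      ∀ a ∈ H, ({a} : Set G₁) * (H : Set G₁) = (H : Set G₁) * {a}) := by
  have hconj : ∀ g : G₂, ∀ d ∈ D, g * d * g⁻¹ ∈ D := fun g _ hd =>
    conj_mem_of_normalizing hqD hDnorm g hd
  have hnoeth := vNoethFull_of_divisorHom hqH hconj fun u v => (hdiv u v).2
  exact ⟨hnoeth, fun hD => ⟨⟨isCIC_of_divisorHom hqH hconj hdiv hD.1, hnoeth hD.2⟩,
    fun _ ha => normalizing_of_divisorHom hDnorm hdiv ha⟩⟩
end
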